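/- For every λ > 0 and every n ≥ 2, the n-th moment of ν_λ is given by the combinatorial formula ∫_ℝ x^n dν_λ(x) = Σ_{j=1}^{⌊n/2⌋} Σ_{(q_1,…,q_j)} Π_{h=1}^{j} Σ_{k=0}^{⌊(q_h−2)/2⌋} binom(q_h − 2, 2k) · λ^{q_h−2−2k} · (2k−1)!!/(k+1)!, where the inner sum Σ_{(q_1,…,q_j)} runs over all compositions (q_1, …, q_j) of n into j parts with every part q_h ≥ 2, and (2k−1)!! denotes the double factorial with the convention (−1)!! = 1. -/

import Mathlib

open MeasureTheory

-- Absolutely continuous part of `ν_λ`: density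
-- `x ↦ √(2 − (x − λ)²)/(π(λ² + 2 − (x − λ)²))` on `(λ − √2, λ + √2)`, `0` elsewhere.
open Classical in
noncomputable def nuAC (lam : ℝ) : Measure ℝ :=
  volume.withDensity fun x =>
    ENNReal.ofReal (if x ∈ Set.Ioo (lam - Real.sqrt 2) (lam + Real.sqrt 2) then
      Real.sqrt (2 - (x - lam) ^ 2) / (Real.pi * (lam ^ 2 + 2 - (x - lam) ^ 2)) else 0)

-- `ν_λ = (λ/√(λ²+2))·δ_{λ−√(λ²+2)} + ν^{ac}_λ`.
noncomputable def nuMeas (lam : ℝ) : Measure ℝ :=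
  (ENNReal.ofReal (lam / Real.sqrt (lam ^ 2 + 2))) •
      Measure.dirac (lam - Real.sqrt (lam ^ 2 + 2)) + nuAC lam

/-- The moments of the semicircle law of variance `1/2` centred at `lam`. -/
noncomputable def semicircleMoment (lam : ℝ) (m : ℕ) : ℝ :=
  ∑ k ∈ Finset.range (m / 2 + 1),
    (m.choose (2 * k) : ℝ) * lam ^ (m - 2 * k) *
      (Nat.doubleFactorial (2 * k - 1) : ℝ) / ((k + 1).factorial : ℝ)

lemma doubleFactorial_div_succ (k : ℕ) :
    (Nat.doubleFactorial (2 * (k + 1) - 1) : ℝ) / ((k + 1 + 1).factorial : ℝ) =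
      (2 * k + 1) / (k + 2) * ((Nat.doubleFactorial (2 * k - 1) : ℝ) / ((k + 1).factorial : ℝ)) := by
  have h : Nat.doubleFactorial (2 * (k + 1) - 1)
      = (2 * k + 1) * Nat.doubleFactorial (2 * k - 1) := by
    rcases k with _ | k
    · simp
    · exact Nat.doubleFactorial_add_two (2 * k + 1)
  rw [h, Nat.factorial_succ (k + 1)]
  have : ((k + 1).factorial : ℝ) ≠ 0 := by positivity
  push_cast
  have h2 : (k : ℝ) + 2 ≠ 0 := by positivity
  have h3 : (k : ℝ) + 1 + 1 ≠ 0 := by positivity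
  field_simp
  ring

lemma doubleFactorial_div_eq_catalan (k : ℕ) :
    (Nat.doubleFactorial (2 * k - 1) : ℝ) / ((k + 1).factorial : ℝ) = catalan k / 2 ^ k := by
  induction k with
  | zero => simp
  | succ k ih =>
    rw [doubleFactorial_div_succ, ih]
    have h1 : ((k : ℝ) + 1) * catalan k = k.centralBinom := by
      exact_mod_cast succ_mul_catalan_eq_centralBinom k
    have h2 : ((k : ℝ) + 1 + 1) * catalan (k + 1) = (k + 1).centralBinom := by
      exact_mod_cast succ_mul_catalan_eq_centralBinom (k + 1)
    have h3 : ((k : ℝ) + 1) * (k + 1).centralBinom = 2 * (2 * k + 1) * k.centralBinom := by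
      exact_mod_cast Nat.succ_mul_centralBinom_succ k
    rw [← h1, ← h2] at h3
    have h4 : ((k : ℝ) + 2) * catalan (k + 1) = 2 * (2 * k + 1) * catalan k := by
      have : (k : ℝ) + 1 ≠ 0 := by positivity
      apply mul_left_cancel₀ this
      linear_combination h3
    have : (k : ℝ) + 2 ≠ 0 := by positivity
    rw [pow_succ, div_mul_div_comm, div_eq_div_iff (by positivity) (by positivity)]
    linear_combination (-2 ^ k : ℝ) * h4

section PowerSeries

open PowerSeries

lemma coeff_geometric_pow (lam : ℝ) (d n : ℕ) :
    coeff n ((mk fun i => lam ^ i : ℝ⟦X⟧) ^ (d + 1)) = (d + n).choose d * lam ^ n := by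
  have h1 : (mk fun i => lam ^ i : ℝ⟦X⟧) = rescale lam (mk 1) := by
    ext i; simp [coeff_rescale]
  rw [h1, ← map_pow, coeff_rescale, mk_one_pow_eq_mk_choose_add, coeff_mk, mul_comm]

lemma semicircleMoment_series (lam : ℝ) :
    (mk (semicircleMoment lam)) * (1 - C lam * X) =
      1 + C (1 / 2) * X ^ 2 * (mk (semicircleMoment lam)) ^ 2 := by
  set R : ℝ⟦X⟧ := mk fun i => lam ^ i with hR
  have hR1 : R * (1 - C lam * X) = 1 := by
    ext n
    rcases n with _ | n
    · simp [hR]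
    · rw [mul_sub, mul_one, map_sub, mul_left_comm, coeff_C_mul, coeff_succ_mul_X]
      simp [hR, coeff_one, pow_succ, mul_comm]
  set Y : ℝ⟦X⟧ := C (1 / 2) * (X * R) ^ 2 with hY
  have hYs : HasSubst Y := HasSubst.of_constantCoeff_zero' (by simp [hY])
  set f : ℝ⟦X⟧ := catalanSeries.map (Nat.castRingHom ℝ) with hf
  have hfe : f ^ 2 * X + 1 = f := by
    have := congrArg (PowerSeries.map (Nat.castRingHom ℝ)) catalanSeries_sq_mul_X_add_one
    simpa using this
  have hfY : f.subst Y = 1 + Y * (f.subst Y) ^ 2 := by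
    have := congrArg (substAlgHom hYs) hfe
    simp only [map_add, map_mul, map_pow, map_one, substAlgHom_X, coe_substAlgHom] at this
    linear_combination -this
  have hS : mk (semicircleMoment lam) = R * f.subst Y := by
    ext m
    have hsplit : f = X ^ (m / 2 + 1) * (mk fun i => coeff (i + (m / 2 + 1)) f) +
        ((trunc (m / 2 + 1) f : Polynomial ℝ) : ℝ⟦X⟧) :=
      eq_X_pow_mul_shift_add_trunc (m / 2 + 1) f
    have hsub : f.subst Y = ∑ k ∈ Finset.range (m / 2 + 1), C (catalan k : ℝ) * Y ^ k +
        Y ^ (m / 2 + 1) * (substAlgHom hYs) (mk fun i => coeff (i + (m / 2 + 1)) f) := by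
      have := congrArg (substAlgHom hYs) hsplit
      rw [map_add, map_mul, map_pow, substAlgHom_X, substAlgHom_coe,
        Polynomial.aeval_eq_sum_range' (natDegree_trunc_lt f (m / 2)), coe_substAlgHom] at this
      rw [this, add_comm, coe_substAlgHom]
      congr 1
      refine Finset.sum_congr rfl fun k hk => ?_
      rw [coeff_trunc, if_pos (Finset.mem_range.mp hk), hf, coeff_map, catalanSeries_coeff,
        smul_eq_C_mul]
      rfl
    rw [coeff_mk, hsub, mul_add, map_add]
    have h0 : coeff m (R * (Y ^ (m / 2 + 1) *
        (substAlgHom hYs) (mk fun i => coeff (i + (m / 2 + 1)) f))) = 0 := by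
      apply X_pow_dvd_iff.mp _ m (show m < 2 * (m / 2 + 1) by omega)
      apply Dvd.dvd.mul_left
      apply Dvd.dvd.mul_right
      rw [pow_mul]
      apply pow_dvd_pow_of_dvd
      exact ⟨C (1 / 2) * R ^ 2, by rw [hY]; ring⟩
    rw [h0, add_zero, Finset.mul_sum, map_sum, semicircleMoment]
    refine Finset.sum_congr rfl fun k hk => ?_
    have hk' : 2 * k ≤ m := by have := Finset.mem_range.mp hk; omega
    have e : R * (C (catalan k : ℝ) * Y ^ k) =
        C ((catalan k : ℝ) * (1 / 2) ^ k) * (X ^ (2 * k) * R ^ (2 * k + 1)) := by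
      rw [hY, map_mul, map_pow]; ring
    rw [e, coeff_C_mul, coeff_X_pow_mul', if_pos hk', hR, coeff_geometric_pow,
      Nat.add_sub_cancel' hk', mul_div_assoc, doubleFactorial_div_eq_catalan, one_div, inv_pow]
    ring
  rw [hS]
  have e2 : R * f.subst Y * (1 - C lam * X) = f.subst Y := by linear_combination f.subst Y * hR1
  rw [e2]
  nth_rewrite 1 [hfY]
  rw [hY]
  ring

lemma coeff_pow_eq_sum (u : ℝ⟦X⟧) (n j : ℕ) :
    coeff n (u ^ j) = ∑ q : Fin j → Fin (n + 1),
      if ∑ h, (q h : ℕ) = n then ∏ h, coeff (q h : ℕ) u else 0 := by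
  have ht : (trunc (n + 1) u : ℝ⟦X⟧) = ∑ i : Fin (n + 1), C (coeff (i : ℕ) u) * X ^ (i : ℕ) := by
    rw [Fin.sum_univ_eq_sum_range (fun i => C (coeff i u) * X ^ i)]
    ext d
    simp [coeff_trunc, coeff_X_pow]
  have h1 : coeff n (u ^ j) = coeff n ((trunc (n + 1) u : ℝ⟦X⟧) ^ j) := by
    rw [← coeff_coe_trunc_of_lt n.lt_succ_self, ← trunc_trunc_pow,
      coeff_coe_trunc_of_lt n.lt_succ_self]
  rw [h1, ht, Fintype.sum_pow, map_sum]
  refine Finset.sum_congr rfl fun q _ => ?_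
  rw [Finset.prod_mul_distrib, ← map_prod, coeff_C_mul, Finset.prod_pow_eq_pow_sum, coeff_X_pow]
  simp [eq_comm]

lemma coeff_eq_sum_compositions {s m : ℕ → ℝ} (n : ℕ) (hn : n ≠ 0)
    (h : mk m * (1 - X ^ 2 * mk s) = 1) :
    m n = ∑ j ∈ Finset.Icc 1 (n / 2), ∑ q : Fin j → Fin (n + 1),
        if (∀ h, 2 ≤ (q h : ℕ)) ∧ (∑ h, (q h : ℕ)) = n then ∏ h, s ((q h : ℕ) - 2) else 0 := by
  set u : ℝ⟦X⟧ := X ^ 2 * mk s with hu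
  have hgeom : mk m = ∑ j ∈ Finset.range (n / 2 + 1), u ^ j + u ^ (n / 2 + 1) * mk m := by
    have := geom_sum_mul_neg u (n / 2 + 1)
    linear_combination (mk m) * (-this) + (∑ j ∈ Finset.range (n / 2 + 1), u ^ j) * h
  have h0 : coeff n (u ^ (n / 2 + 1) * mk m) = 0 := by
    apply X_pow_dvd_iff.mp _ n (show n < 2 * (n / 2 + 1) by omega)
    apply Dvd.dvd.mul_right
    rw [pow_mul]
    exact pow_dvd_pow_of_dvd ⟨_, hu⟩ _
  have h1 := congrArg (coeff n) hgeom
  rw [map_add, h0, add_zero, coeff_mk, map_sum, Finset.sum_range_eq_add_Ico _ (by omega),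
    pow_zero, coeff_one, if_neg hn, zero_add] at h1
  rw [h1]
  refine Finset.sum_congr rfl fun j _ => ?_
  rw [coeff_pow_eq_sum]
  refine Finset.sum_congr rfl fun q _ => ?_
  by_cases hq : ∀ h, 2 ≤ (q h : ℕ)
  · have : ∏ h, coeff (q h : ℕ) u = ∏ h, s ((q h : ℕ) - 2) :=
      Finset.prod_congr rfl fun i _ => by rw [hu, coeff_X_pow_mul', if_pos (hq i), coeff_mk]
    simp [hq, this]
  · rw [if_neg (c := (∀ h, 2 ≤ (q h : ℕ)) ∧ _) (fun hc => hq hc.1)]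
    push Not at hq
    obtain ⟨i, hi⟩ := hq
    have : ∏ h, coeff (q h : ℕ) u = 0 :=
      Finset.prod_eq_zero (Finset.mem_univ i) (by rw [hu, coeff_X_pow_mul', if_neg (by omega)])
    simp [this]

/-- A sequence starting with `1, 0` and satisfying the three-term recurrence driven by the
semicircle moments has the reciprocal of `1 - X² S` as its generating series. -/
lemma mk_mul_one_sub_eq_one (lam : ℝ) (m : ℕ → ℝ) (h0 : m 0 = 1) (h1 : m 1 = 0)
    (hrec : ∀ n, 2 * m n + 2 * lam * m (n + 1) - m (n + 2) = semicircleMoment lam n) :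
    mk m * (1 - X ^ 2 * mk (semicircleMoment lam)) = 1 := by
  set S : ℝ⟦X⟧ := mk (semicircleMoment lam) with hS
  have hq := semicircleMoment_series lam
  rw [← hS] at hq
  have hC : (C (1 / 2 : ℝ) : ℝ⟦X⟧) * 2 = 1 := by
    rw [show (2 : ℝ⟦X⟧) = C (2 : ℝ) from (map_ofNat C 2).symm, ← map_mul]; norm_num
  have hq2 : 2 * S * (1 - C lam * X) = 2 + X ^ 2 * S ^ 2 := by
    linear_combination 2 * hq + X ^ 2 * S ^ 2 * hC
  have hM : (2 * X ^ 2 + 2 * C lam * X - 1) * mk m = X ^ 2 * S + 2 * C lam * X - 1 := by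
    have h2 : (2 : ℝ⟦X⟧) = C (2 : ℝ) := (map_ofNat C 2).symm
    rw [h2]
    ext n
    simp only [add_mul, sub_mul, map_add, map_sub, mul_assoc, coeff_C_mul, one_mul]
    rcases n with _ | _ | n
    · simp [h0, coeff_X_pow_mul']
    · simp [h0, h1, coeff_X_pow_mul', coeff_one]
    · rw [show n + 1 + 1 = n + 2 from rfl, coeff_X_pow_mul, coeff_X_pow_mul,
        show n + 2 = n + 1 + 1 from rfl, coeff_succ_X_mul]
      simp [coeff_one, coeff_X, hS, ← hrec n]
      ring
  have hne : (2 * X ^ 2 + 2 * C lam * X - 1 : ℝ⟦X⟧) ≠ 0 := by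
    intro h
    have := congrArg constantCoeff h
    simp at this
  apply mul_left_cancel₀ hne
  linear_combination (1 - X ^ 2 * S) * hM + X ^ 2 * hq2

end PowerSeries

lemma sq_le_two_of_mem_Icc {y : ℝ} (hy : y ∈ Set.Icc (-√2) (√2)) : y ^ 2 ≤ 2 :=
  Real.sq_le (by norm_num) |>.mpr hy

lemma sq_lt_two_of_mem_Ioo {y : ℝ} (hy : y ∈ Set.Ioo (-√2) (√2)) : y ^ 2 < 2 :=
  Real.sq_lt.mpr hy

lemma neg_sqrt_two_le_sqrt_two : -√2 ≤ √2 := by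
  have := Real.sqrt_nonneg 2
  linarith

lemma hasDerivAt_sqrt_two_sub_sq {y : ℝ} (hy : y ^ 2 < 2) :
    HasDerivAt (fun y : ℝ => √(2 - y ^ 2)) (-y / √(2 - y ^ 2)) y := by
  have h := ((hasDerivAt_pow 2 y).const_sub 2).sqrt (by linarith)
  convert h using 1
  have : √(2 - y ^ 2) ≠ 0 := (Real.sqrt_pos.mpr (by linarith)).ne'
  field_simp
  ring

lemma integral_pow_mul_sqrt_two_sub_sq_aux (k : ℕ) :
    ∫ y in (-√2)..√2, ((k : ℝ) * y ^ (k - 1) * (2 - y ^ 2) * √(2 - y ^ 2)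
      - 3 * (y ^ (k + 1) * √(2 - y ^ 2))) = 0 := by
  rw [intervalIntegral.integral_eq_sub_of_hasDerivAt_of_le neg_sqrt_two_le_sqrt_two
    (f := fun y => y ^ k * ((2 - y ^ 2) * √(2 - y ^ 2)))]
  · simp
  · fun_prop
  · intro y hy
    have hy2 := sq_lt_two_of_mem_Ioo hy
    have h := (hasDerivAt_pow k y).mul
      (((hasDerivAt_pow 2 y).const_sub 2).mul (hasDerivAt_sqrt_two_sub_sq hy2))
    refine HasDerivAt.congr_deriv h ?_
    have h0 : √(2 - y ^ 2) ≠ 0 := (Real.sqrt_pos.mpr (by linarith)).ne'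
    have h1 : √(2 - y ^ 2) ^ 2 = 2 - y ^ 2 := Real.sq_sqrt (by linarith)
    have h2 : (2 - y ^ 2) * (-y / √(2 - y ^ 2)) = -y * √(2 - y ^ 2) := by
      field_simp
      linear_combination y * h1
    simp only [Pi.mul_apply]
    rw [h2]
    push_cast
    ring
  · apply Continuous.intervalIntegrable
    fun_prop

lemma integral_pow_mul_sqrt_two_sub_sq_succ_succ (k : ℕ) :
    (k + 4 : ℝ) * ∫ y in (-√2)..√2, y ^ (k + 2) * √(2 - y ^ 2) =
      2 * (k + 1) * ∫ y in (-√2)..√2, y ^ k * √(2 - y ^ 2) := by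
  have h := integral_pow_mul_sqrt_two_sub_sq_aux (k + 1)
  have e : (fun y : ℝ => ((k + 1 : ℕ) : ℝ) * y ^ (k + 1 - 1) * (2 - y ^ 2) * √(2 - y ^ 2)
      - 3 * (y ^ (k + 1 + 1) * √(2 - y ^ 2))) =
      fun y => 2 * (k + 1) * (y ^ k * √(2 - y ^ 2)) - (k + 4) * (y ^ (k + 2) * √(2 - y ^ 2)) := by
    ext y
    rw [Nat.add_sub_cancel]
    push_cast
    ring
  rw [e, intervalIntegral.integral_sub, intervalIntegral.integral_const_mul,
    intervalIntegral.integral_const_mul] at h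
  · linarith
  all_goals
    apply Continuous.intervalIntegrable
    fun_prop

lemma integral_odd_pow_mul_sqrt_two_sub_sq (k : ℕ) :
    ∫ y in (-√2)..√2, y ^ (2 * k + 1) * √(2 - y ^ 2) = 0 := by
  induction k with
  | zero =>
    have h := integral_pow_mul_sqrt_two_sub_sq_aux 0
    simpa using h
  | succ k ih =>
    have h := integral_pow_mul_sqrt_two_sub_sq_succ_succ (2 * k + 1)
    rw [ih, mul_zero] at h
    exact (mul_eq_zero.mp h).resolve_left (by positivity)

lemma integral_sqrt_two_sub_sq : ∫ y in (-√2)..√2, √(2 - y ^ 2) = Real.pi := by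
  have h := intervalIntegral.integral_comp_mul_left (a := -1) (b := 1)
    (fun y : ℝ => √(2 - y ^ 2)) (c := √2) (by positivity)
  have e : (fun x : ℝ => √(2 - (√2 * x) ^ 2)) = fun x => √2 * √(1 - x ^ 2) := by
    ext x
    rw [← Real.sqrt_mul (by norm_num), mul_pow, Real.sq_sqrt (by norm_num)]
    ring_nf
  rw [e, intervalIntegral.integral_const_mul, integral_sqrt_one_sub_sq, mul_neg, mul_one,
    smul_eq_mul] at h
  have h2 : √2 * √2 = 2 := Real.mul_self_sqrt (by norm_num)
  have h0 : √2 ≠ 0 := by positivity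
  field_simp at h
  rw [pow_two, h2] at h
  linarith

lemma integral_even_pow_mul_sqrt_two_sub_sq (k : ℕ) :
    ∫ y in (-√2)..√2, y ^ (2 * k) * √(2 - y ^ 2) =
      Real.pi * ((Nat.doubleFactorial (2 * k - 1) : ℝ) / ((k + 1).factorial : ℝ)) := by
  induction k with
  | zero => simpa using integral_sqrt_two_sub_sq
  | succ k ih =>
    have h := integral_pow_mul_sqrt_two_sub_sq_succ_succ (2 * k)
    rw [ih] at h
    rw [doubleFactorial_div_succ]
    have h0 : ((2 * k : ℕ) + 4 : ℝ) ≠ 0 := by positivity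
    apply mul_left_cancel₀ h0
    rw [show 2 * (k + 1) = 2 * k + 2 by ring, h]
    have h1 : (k : ℝ) + 2 ≠ 0 := by positivity
    push_cast
    field_simp
    ring

lemma integral_shift_pow_mul_sqrt_two_sub_sq (lam : ℝ) (n : ℕ) :
    ∫ y in (-√2)..√2, (lam + y) ^ n * √(2 - y ^ 2) = Real.pi * semicircleMoment lam n := by
  have e : (fun y : ℝ => (lam + y) ^ n * √(2 - y ^ 2)) = fun y => ∑ i ∈ Finset.range (n + 1),
      (lam ^ (n - i) * n.choose i) * (y ^ i * √(2 - y ^ 2)) := by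
    ext y
    rw [add_comm, add_pow, Finset.sum_mul]
    exact Finset.sum_congr rfl fun i _ => by ring
  rw [e, intervalIntegral.integral_finsetSum]
  · simp_rw [intervalIntegral.integral_const_mul]
    rw [semicircleMoment, Finset.mul_sum]
    symm
    apply Finset.sum_of_injOn (fun k => 2 * k)
    · intro a _ b _ h
      simpa using h
    · intro k hk
      simp only [Finset.coe_range, Set.mem_Iio] at hk ⊢
      omega
    · intro i hi hi2
      obtain ⟨k, rfl | rfl⟩ := Nat.even_or_odd' i
      · exfalso
        apply hi2
        simp only [Finset.mem_range] at hi
        exact ⟨k, by simp; omega, rfl⟩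
      · rw [integral_odd_pow_mul_sqrt_two_sub_sq, mul_zero]
    · intro k _
      simp only [integral_even_pow_mul_sqrt_two_sub_sq]
      ring
  · intro i _
    apply Continuous.intervalIntegrable
    fun_prop

lemma continuousOn_sqrt_two_sub_sq_div {lam : ℝ} (hlam : 0 < lam) :
    ContinuousOn (fun y => √(2 - y ^ 2) / (lam ^ 2 + 2 - y ^ 2)) (Set.Icc (-√2) (√2)) := by
  refine ContinuousOn.div (by fun_prop) (by fun_prop) fun y hy => ?_
  have := sq_le_two_of_mem_Icc hy
  have : 0 < lam ^ 2 + 2 - y ^ 2 := by nlinarith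
  exact this.ne'

lemma intervalIntegrable_mul_sqrt_two_sub_sq_div {lam : ℝ} (hlam : 0 < lam) {f : ℝ → ℝ}
    (hf : Continuous f) : IntervalIntegrable
      (fun y => f y * (√(2 - y ^ 2) / (lam ^ 2 + 2 - y ^ 2))) volume (-√2) (√2) := by
  apply ContinuousOn.intervalIntegrable
  rw [Set.uIcc_of_le neg_sqrt_two_le_sqrt_two]
  exact hf.continuousOn.mul (continuousOn_sqrt_two_sub_sq_div hlam)

lemma hasDerivAt_arcsin_aux {lam y : ℝ} (hlam : 0 < lam) (hy : y ^ 2 < 2) :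
    HasDerivAt (fun y => Real.arcsin (lam * y / √(2 * (lam ^ 2 + 2 - y ^ 2))))
      (lam * √(lam ^ 2 + 2) / ((lam ^ 2 + 2 - y ^ 2) * √(2 - y ^ 2))) y := by
  have hD : 0 < lam ^ 2 + 2 - y ^ 2 := by nlinarith
  have hr : HasDerivAt (fun y => √(2 * (lam ^ 2 + 2 - y ^ 2)))
      (-2 * y / √(2 * (lam ^ 2 + 2 - y ^ 2))) y := by
    have h := (((hasDerivAt_pow 2 y).const_sub (lam ^ 2 + 2)).const_mul 2).sqrt (by positivity)
    convert h using 1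
    have : √(2 * (lam ^ 2 + 2 - y ^ 2)) ≠ 0 := by positivity
    field_simp
    ring
  set r := √(2 * (lam ^ 2 + 2 - y ^ 2)) with hrdef
  have hrpos : 0 < r := by positivity
  have hr2 : r ^ 2 = 2 * (lam ^ 2 + 2 - y ^ 2) := Real.sq_sqrt (by positivity)
  have hv := ((hasDerivAt_id y).const_mul lam).div hr hrpos.ne'
  have h1v : 1 - (lam * y / r) ^ 2 = (2 - y ^ 2) * (lam ^ 2 + 2) / r ^ 2 := by
    field_simp
    rw [hr2]
    ring
  have hpos : 0 < 1 - (lam * y / r) ^ 2 := by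
    rw [h1v]
    have : 0 < 2 - y ^ 2 := by linarith
    positivity
  have hsq : √(1 - (lam * y / r) ^ 2) = √(2 - y ^ 2) * √(lam ^ 2 + 2) / r := by
    rw [h1v, Real.sqrt_div' _ (by positivity), Real.sqrt_sq hrpos.le,
      Real.sqrt_mul (by linarith)]
  have h := (Real.hasDerivAt_arcsin (x := lam * y / r) (by nlinarith) (by nlinarith)).comp y hv
  refine HasDerivAt.congr_deriv h ?_
  rw [hsq]
  have h2 : 0 < √(2 - y ^ 2) := Real.sqrt_pos.mpr (by linarith)
  have h3 : 0 < √(lam ^ 2 + 2) := by positivity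
  have h4 : √(lam ^ 2 + 2) ^ 2 = lam ^ 2 + 2 := Real.sq_sqrt (by positivity)
  simp only [id, ← hrdef]
  field_simp
  rw [h4, hr2]
  ring

lemma integral_sqrt_two_sub_sq_div {lam : ℝ} (hlam : 0 < lam) :
    ∫ y in (-√2)..√2, √(2 - y ^ 2) / (lam ^ 2 + 2 - y ^ 2) =
      Real.pi * (1 - lam / √(lam ^ 2 + 2)) := by
  have h2 : (0 : ℝ) < √2 := by positivity
  rw [intervalIntegral.integral_eq_sub_of_hasDerivAt_of_le neg_sqrt_two_le_sqrt_two
    (f := fun y => Real.arcsin (y / √2) - lam / √(lam ^ 2 + 2) *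
      Real.arcsin (lam * y / √(2 * (lam ^ 2 + 2 - y ^ 2))))]
  · have e : √(2 * (lam ^ 2 + 2 - √2 ^ 2)) = lam * √2 := by
      rw [Real.sq_sqrt (by norm_num), add_sub_cancel_right, Real.sqrt_mul (by norm_num),
        Real.sqrt_sq hlam.le, mul_comm]
    have e1 : lam * √2 / (lam * √2) = 1 := div_self (by positivity)
    simp only [neg_sq, e, mul_neg, neg_div, div_self h2.ne', e1, Real.arcsin_neg, Real.arcsin_one]
    ring
  · refine ContinuousOn.sub (by fun_prop) (continuousOn_const.mul ?_)
    apply Real.continuous_arcsin.comp_continuousOn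
    refine ContinuousOn.div (by fun_prop) (by fun_prop) fun y hy => ?_
    have := sq_le_two_of_mem_Icc hy
    have : 0 < lam ^ 2 + 2 - y ^ 2 := by nlinarith
    positivity
  · intro y hy
    have hy2 := sq_lt_two_of_mem_Ioo hy
    have hD : 0 < lam ^ 2 + 2 - y ^ 2 := by nlinarith
    have h3 : 0 < √(2 - y ^ 2) := Real.sqrt_pos.mpr (by linarith)
    have h4 : √(2 - y ^ 2) ^ 2 = 2 - y ^ 2 := Real.sq_sqrt (by linarith)
    have h5 : 0 < √(lam ^ 2 + 2) := by positivity
    have hs2 : √2 ^ 2 = 2 := Real.sq_sqrt (by norm_num)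
    have hlt : (y / √2) ^ 2 < 1 := by
      rw [div_pow, hs2]
      linarith
    have e : √(1 - (y / √2) ^ 2) = √(2 - y ^ 2) / √2 := by
      rw [← Real.sqrt_div' _ (by norm_num), div_pow, hs2]
      ring_nf
    have ha : HasDerivAt (fun y => Real.arcsin (y / √2)) (1 / √(2 - y ^ 2)) y := by
      have h := (Real.hasDerivAt_arcsin (x := y / √2) (by nlinarith) (by nlinarith)).comp y
        ((hasDerivAt_id y).div_const (√2))
      refine HasDerivAt.congr_deriv h ?_
      rw [e]
      field_simp
    refine HasDerivAt.congr_deriv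
      (ha.sub ((hasDerivAt_arcsin_aux hlam hy2).const_mul (lam / √(lam ^ 2 + 2)))) ?_
    field_simp
    rw [h4]
    ring
  · simpa using intervalIntegrable_mul_sqrt_two_sub_sq_div hlam (f := fun _ => 1) (by fun_prop)

lemma integral_mul_sqrt_two_sub_sq_div (lam : ℝ) :
    ∫ y in (-√2)..√2, y * (√(2 - y ^ 2) / (lam ^ 2 + 2 - y ^ 2)) = 0 := by
  have h := intervalIntegral.integral_comp_neg (a := -√2) (b := √2)
    (fun y : ℝ => y * (√(2 - y ^ 2) / (lam ^ 2 + 2 - y ^ 2)))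
  simp only [neg_sq, neg_mul, neg_neg, intervalIntegral.integral_neg] at h
  linarith

lemma nuAC_eq_withDensity (lam : ℝ) :
    nuAC lam = volume.withDensity fun x => ENNReal.ofReal
      (Real.pi⁻¹ * (√(2 - (x - lam) ^ 2) / (lam ^ 2 + 2 - (x - lam) ^ 2))) := by
  rw [nuAC]
  congr 1
  ext x
  congr 1
  split_ifs with h
  · rw [inv_mul_eq_div, div_div, mul_comm Real.pi]
  · have : √(2 - (x - lam) ^ 2) = 0 := by
      apply Real.sqrt_eq_zero_of_nonpos
      by_contra hc
      have := Real.sq_lt.mp (show (x - lam) ^ 2 < 2 by linarith)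
      exact h ⟨by linarith [this.1], by linarith [this.2]⟩
    simp [this]

lemma sqrt_two_sub_sq_div_nonneg (lam y : ℝ) : 0 ≤ √(2 - y ^ 2) / (lam ^ 2 + 2 - y ^ 2) := by
  by_cases h : y ^ 2 ≤ 2
  · exact div_nonneg (Real.sqrt_nonneg _) (by nlinarith)
  · simp [Real.sqrt_eq_zero_of_nonpos (show 2 - y ^ 2 ≤ 0 by linarith)]

lemma support_mul_sqrt_two_sub_sq_div_subset (lam : ℝ) (f : ℝ → ℝ) :
    Function.support (fun y => f y * (√(2 - y ^ 2) / (lam ^ 2 + 2 - y ^ 2))) ⊆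
      Set.Ioc (-√2) (√2) := by
  intro y hy
  by_contra hc
  apply hy
  have : √(2 - y ^ 2) = 0 := by
    apply Real.sqrt_eq_zero_of_nonpos
    by_contra hlt
    exact hc (Set.Ioo_subset_Ioc_self (Real.sq_lt.mp (show y ^ 2 < 2 by linarith)))
  simp [this]

lemma integrable_mul_sqrt_two_sub_sq_div {lam : ℝ} (hlam : 0 < lam) {f : ℝ → ℝ}
    (hf : Continuous f) :
    Integrable fun y => f y * (√(2 - y ^ 2) / (lam ^ 2 + 2 - y ^ 2)) := by
  rw [← integrableOn_iff_integrable_of_support_subset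
    (support_mul_sqrt_two_sub_sq_div_subset lam f)]
  exact (intervalIntegrable_iff_integrableOn_Ioc_of_le neg_sqrt_two_le_sqrt_two).mp
    (intervalIntegrable_mul_sqrt_two_sub_sq_div hlam hf)

lemma integrable_nuAC {lam : ℝ} (hlam : 0 < lam) {f : ℝ → ℝ} (hf : Continuous f) :
    Integrable f (nuAC lam) := by
  rw [nuAC_eq_withDensity, integrable_withDensity_iff_integrable_smul' (by fun_prop) (by simp)]
  have h := ((integrable_mul_sqrt_two_sub_sq_div hlam
    (hf.comp (continuous_id.add_const lam))).comp_sub_right lam).const_mul Real.pi⁻¹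
  refine h.congr (ae_of_all _ fun x => ?_)
  simp only
  rw [ENNReal.toReal_ofReal (mul_nonneg (by positivity) (sqrt_two_sub_sq_div_nonneg _ _))]
  simp only [Function.comp, id, sub_add_cancel, smul_eq_mul]
  ring

lemma integral_nuAC (lam : ℝ) (f : ℝ → ℝ) :
    ∫ x, f x ∂(nuAC lam) = Real.pi⁻¹ *
      ∫ y in (-√2)..√2, f (lam + y) * (√(2 - y ^ 2) / (lam ^ 2 + 2 - y ^ 2)) := by
  rw [nuAC_eq_withDensity, integral_withDensity_eq_integral_toReal_smul (by fun_prop) (by simp),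
    intervalIntegral.integral_eq_integral_of_support_subset
      (support_mul_sqrt_two_sub_sq_div_subset lam fun y => f (lam + y)),
    ← integral_const_mul, ← integral_add_right_eq_self _ lam]
  congr 1
  ext x
  rw [ENNReal.toReal_ofReal (mul_nonneg (by positivity) (sqrt_two_sub_sq_div_nonneg _ _)),
    add_sub_cancel_right, smul_eq_mul, add_comm x lam]
  ring

lemma integral_nuMeas {lam : ℝ} (hlam : 0 < lam) {f : ℝ → ℝ} (hf : Continuous f) :
    ∫ x, f x ∂(nuMeas lam) = lam / √(lam ^ 2 + 2) * f (lam - √(lam ^ 2 + 2)) + Real.pi⁻¹ *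
      ∫ y in (-√2)..√2, f (lam + y) * (√(2 - y ^ 2) / (lam ^ 2 + 2 - y ^ 2)) := by
  rw [nuMeas, integral_add_measure _ (integrable_nuAC hlam hf), integral_smul_measure,
    integral_dirac, integral_nuAC, ENNReal.toReal_ofReal (by positivity), smul_eq_mul]
  exact (integrable_dirac (by simp)).smul_measure (by simp)

lemma integral_nuMeas_one {lam : ℝ} (hlam : 0 < lam) : ∫ x, x ^ 0 ∂(nuMeas lam) = 1 := by
  rw [integral_nuMeas hlam (by fun_prop)]
  simp only [pow_zero, one_mul, mul_one]
  rw [integral_sqrt_two_sub_sq_div hlam]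
  field_simp
  ring

lemma integral_nuMeas_id {lam : ℝ} (hlam : 0 < lam) : ∫ x, x ^ 1 ∂(nuMeas lam) = 0 := by
  rw [integral_nuMeas hlam (by fun_prop)]
  simp only [pow_one, add_mul]
  rw [intervalIntegral.integral_add, intervalIntegral.integral_const_mul,
    integral_mul_sqrt_two_sub_sq_div, integral_sqrt_two_sub_sq_div hlam]
  · have : 0 < √(lam ^ 2 + 2) := by positivity
    field_simp
    ring
  · exact intervalIntegrable_mul_sqrt_two_sub_sq_div hlam (by fun_prop)
  · exact intervalIntegrable_mul_sqrt_two_sub_sq_div hlam (by fun_prop)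

lemma integral_nuMeas_recurrence {lam : ℝ} (hlam : 0 < lam) (n : ℕ) :
    2 * (∫ x, x ^ n ∂(nuMeas lam)) + 2 * lam * (∫ x, x ^ (n + 1) ∂(nuMeas lam))
      - (∫ x, x ^ (n + 2) ∂(nuMeas lam)) = semicircleMoment lam n := by
  have hint (k : ℕ) := intervalIntegrable_mul_sqrt_two_sub_sq_div hlam
    (f := fun y => (lam + y) ^ k) (by fun_prop)
  have hs : √(lam ^ 2 + 2) ^ 2 = lam ^ 2 + 2 := Real.sq_sqrt (by positivity)
  have key : 2 * (∫ y in (-√2)..√2, (lam + y) ^ n * (√(2 - y ^ 2) / (lam ^ 2 + 2 - y ^ 2)))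
      + 2 * lam * (∫ y in (-√2)..√2, (lam + y) ^ (n + 1) *
        (√(2 - y ^ 2) / (lam ^ 2 + 2 - y ^ 2)))
      - (∫ y in (-√2)..√2, (lam + y) ^ (n + 2) * (√(2 - y ^ 2) / (lam ^ 2 + 2 - y ^ 2)))
      = Real.pi * semicircleMoment lam n := by
    rw [← integral_shift_pow_mul_sqrt_two_sub_sq, ← intervalIntegral.integral_const_mul,
      ← intervalIntegral.integral_const_mul,
      ← intervalIntegral.integral_add ((hint n).const_mul 2) ((hint (n + 1)).const_mul (2 * lam)),
      ← intervalIntegral.integral_sub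
        (((hint n).const_mul 2).add ((hint (n + 1)).const_mul (2 * lam))) (hint (n + 2))]
    apply intervalIntegral.integral_congr
    intro y hy
    rw [Set.uIcc_of_le neg_sqrt_two_le_sqrt_two] at hy
    have := sq_le_two_of_mem_Icc hy
    have : 0 < lam ^ 2 + 2 - y ^ 2 := by nlinarith
    simp only
    field_simp
    ring
  rw [integral_nuMeas hlam (by fun_prop), integral_nuMeas hlam (by fun_prop),
    integral_nuMeas hlam (by fun_prop)]
  have hpi : Real.pi⁻¹ * Real.pi = 1 := inv_mul_cancel₀ Real.pi_ne_zero
  linear_combination Real.pi⁻¹ * key + semicircleMoment lam n * hpi -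
    lam / √(lam ^ 2 + 2) * (lam - √(lam ^ 2 + 2)) ^ n * hs

theorem stmt15 (lam : ℝ) (hlam : 0 < lam) (n : ℕ) (hn : 2 ≤ n) :
    (∫ x, x ^ n ∂(nuMeas lam)) =
      ∑ j ∈ Finset.Icc 1 (n / 2), ∑ q : Fin j → Fin (n + 1),
        if (∀ h, 2 ≤ (q h : ℕ)) ∧ (∑ h, (q h : ℕ)) = n then
          ∏ h, ∑ k ∈ Finset.range (((q h : ℕ) - 2) / 2 + 1),
            (((q h : ℕ) - 2).choose (2 * k) : ℝ) * lam ^ ((q h : ℕ) - 2 - 2 * k) *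
              (Nat.doubleFactorial (2 * k - 1) : ℝ) / ((k + 1).factorial : ℝ)
        else 0 := by
  exact coeff_eq_sum_compositions n (by omega) (mk_mul_one_sub_eq_one lam
    (fun n => ∫ x, x ^ n ∂(nuMeas lam)) (integral_nuMeas_one hlam) (integral_nuMeas_id hlam)
    (integral_nuMeas_recurrence hlam))
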